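/- For a finite simple graph G the following are equivalent: (i) G is a König-Egerváry graph; (ii) every nonempty family of maximum critical independent sets of G is a König-Egerváry collection; (iii) there exists a nonempty family of maximum critical independent sets of G that is a König-Egerváry collection. -/

import Mathlib

/-- `S` is an independent set in `G`: no two of its vertices are adjacent. -/
def IndepSet {V : Type*} (G : SimpleGraph V) (S : Set V) : Prop :=
  ∀ ⦃u⦄, u ∈ S → ∀ ⦃v⦄, v ∈ S → ¬G.Adj u v

/-- The independence number `α(G)`. -/
noncomputable def indNum {V : Type*} (G : SimpleGraph V) : ℕ :=
  sSup {n : ℕ | ∃ S : Set V, IndepSet G S ∧ S.ncard = n}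

/-- `Ω(G)`: the family of maximum independent sets of `G`. -/
def maxIndepFam {V : Type*} (G : SimpleGraph V) : Set (Set V) :=
  {S | IndepSet G S ∧ S.ncard = indNum G}

/-- `N(X)`: the neighborhood of a set of vertices. -/
def nbhd {V : Type*} (G : SimpleGraph V) (X : Set V) : Set V :=
  {v | ∃ x ∈ X, G.Adj v x}

/-- `N[X] = N(X) ∪ X`: the closed neighborhood of a set of vertices. -/
def closedNbhd {V : Type*} (G : SimpleGraph V) (X : Set V) : Set V :=
  nbhd G X ∪ X

/-- The difference `d(X) = |X| - |N(X)|`. -/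
noncomputable def diffd {V : Type*} (G : SimpleGraph V) (X : Set V) : ℤ :=
  (X.ncard : ℤ) - ((nbhd G X).ncard : ℤ)

/-- The critical difference `d(G) = max {d(X) : X ⊆ V(G)}`. -/
noncomputable def critDiff {V : Type*} (G : SimpleGraph V) : ℤ :=
  sSup {d : ℤ | ∃ X : Set V, diffd G X = d}

/-- `X` is a critical set if `d(X) = d(G)`. -/
def IsCritical {V : Type*} (G : SimpleGraph V) (X : Set V) : Prop :=
  diffd G X = critDiff G

/-- `MaxCritIndep(G)`: the family of critical independent sets of maximum cardinality. -/
def maxCritIndepFam {V : Type*} (G : SimpleGraph V) : Set (Set V) :=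
  {S | IndepSet G S ∧ IsCritical G S ∧
    ∀ T : Set V, IndepSet G T → IsCritical G T → T.ncard ≤ S.ncard}

/-- The critical independence number `α'(G)`. -/
noncomputable def critIndNum {V : Type*} (G : SimpleGraph V) : ℕ :=
  sSup {n : ℕ | ∃ S : Set V, IndepSet G S ∧ IsCritical G S ∧ S.ncard = n}

/-- `ker(G)`: the intersection of all critical independent sets. -/
def kerSet {V : Type*} (G : SimpleGraph V) : Set V :=
  ⋂₀ {A : Set V | IndepSet G A ∧ IsCritical G A}

/-- `nucleus(G)`: the intersection of all maximum critical independent sets. -/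
def nucleus {V : Type*} (G : SimpleGraph V) : Set V :=
  ⋂₀ maxCritIndepFam G

/-- `diadem(G)`: the union of all maximum critical independent sets. -/
def diadem {V : Type*} (G : SimpleGraph V) : Set V :=
  ⋃₀ maxCritIndepFam G

/-- `core(G)`: the intersection of all maximum independent sets. -/
def coreSet {V : Type*} (G : SimpleGraph V) : Set V :=
  ⋂₀ maxIndepFam G

/-- `corona(G)`: the union of all maximum independent sets. -/
def coronaSet {V : Type*} (G : SimpleGraph V) : Set V :=
  ⋃₀ maxIndepFam G

/-- A matching in `G`: a set of pairwise non-incident edges of `G`. -/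
def IsMatchingSet {V : Type*} (G : SimpleGraph V) (M : Set (Sym2 V)) : Prop :=
  M ⊆ G.edgeSet ∧ M.Pairwise fun e f => ∀ v, v ∈ e → v ∉ f

/-- The matching number `μ(G)`. -/
noncomputable def matchNum {V : Type*} (G : SimpleGraph V) : ℕ :=
  sSup {n : ℕ | ∃ M : Set (Sym2 V), IsMatchingSet G M ∧ M.ncard = n}

/-- `G` is a König-Egerváry graph if `α(G) + μ(G) = |V(G)|`. -/
def IsKonigEgervary {V : Type*} (G : SimpleGraph V) : Prop :=
  indNum G + matchNum G = Nat.card V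

/-- `Γ` is a König-Egerváry collection: a family of independent sets with
`|⋂Γ| + |⋃Γ| = 2α(G)`. -/
def IsKECollection {V : Type*} (G : SimpleGraph V) (Γ : Set (Set V)) : Prop :=
  (∀ S ∈ Γ, IndepSet G S) ∧ (⋂₀ Γ).ncard + (⋃₀ Γ).ncard = 2 * indNum G

section Criticality

variable {V : Type*} {G : SimpleGraph V}

theorem IsMatchingSet.eq_of_mem {M : Set (Sym2 V)} (hM : IsMatchingSet G M) {e e' : Sym2 V}
    (he : e ∈ M) (he' : e' ∈ M) {v : V} (hv : v ∈ e) (hv' : v ∈ e') : e = e' :=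
  by_contra fun h => hM.2 he he' h v hv hv'

theorem IsMatchingSet.exists_injOn_mapsTo_compl {M : Set (Sym2 V)} (hM : IsMatchingSet G M)
    {S : Set V} (hS : IndepSet G S) :
    ∃ o : Sym2 V → V, Set.InjOn o M ∧ Set.MapsTo o M Sᶜ ∧ ∀ e ∈ M, o e ∈ e := by
  have h : ∀ e : Sym2 V, ∃ v, e ∈ M → v ∈ e ∧ v ∉ S := by
    intro e
    induction e with
    | _ a b =>
      by_cases ha : a ∈ S
      · exact ⟨b, fun he => ⟨by simp, fun hb => hS ha hb (hM.1 he)⟩⟩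
      · exact ⟨a, fun _ => ⟨by simp, ha⟩⟩
  choose o ho using h
  exact ⟨o, fun e he e' he' h => hM.eq_of_mem he he' (ho e he).1 (h ▸ (ho e' he').1),
    fun e he => (ho e he).2, fun e he => (ho e he).1⟩

variable [Finite V]

theorem IndepSet.ncard_le_indNum {S : Set V} (hS : IndepSet G S) : S.ncard ≤ indNum G :=
  le_csSup ⟨Nat.card V, by rintro _ ⟨T, -, rfl⟩; exact Set.ncard_le_card T⟩ ⟨S, hS, rfl⟩

theorem exists_indepSet_ncard_eq_indNum (G : SimpleGraph V) :
    ∃ S : Set V, IndepSet G S ∧ S.ncard = indNum G :=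
  Nat.sSup_mem (s := {n : ℕ | ∃ S : Set V, IndepSet G S ∧ S.ncard = n})
    ⟨_, ∅, fun _ h => h.elim, rfl⟩
    ⟨Nat.card V, by rintro _ ⟨T, -, rfl⟩; exact Set.ncard_le_card T⟩

theorem bddAbove_ncard_matching (G : SimpleGraph V) :
    BddAbove {n : ℕ | ∃ M : Set (Sym2 V), IsMatchingSet G M ∧ M.ncard = n} :=
  ⟨Nat.card (Sym2 V), by rintro _ ⟨T, -, rfl⟩; exact Set.ncard_le_card T⟩

theorem IsMatchingSet.ncard_le_matchNum {M : Set (Sym2 V)} (hM : IsMatchingSet G M) :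
    M.ncard ≤ matchNum G :=
  le_csSup (bddAbove_ncard_matching G) ⟨M, hM, rfl⟩

theorem exists_isMatchingSet_ncard_eq_matchNum (G : SimpleGraph V) :
    ∃ M : Set (Sym2 V), IsMatchingSet G M ∧ M.ncard = matchNum G :=
  Nat.sSup_mem (s := {n : ℕ | ∃ M : Set (Sym2 V), IsMatchingSet G M ∧ M.ncard = n})
    ⟨_, ∅, ⟨by simp, by simp⟩, rfl⟩ (bddAbove_ncard_matching G)

theorem diffd_le_critDiff (G : SimpleGraph V) (X : Set V) : diffd G X ≤ critDiff G :=
  le_csSup (Set.finite_range (diffd G)).bddAbove ⟨X, rfl⟩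

theorem exists_isCritical (G : SimpleGraph V) : ∃ X : Set V, IsCritical G X :=
  (Set.range_nonempty (diffd G)).csSup_mem (Set.finite_range (diffd G))

theorem isCritical_of_critDiff_le {X : Set V} (h : critDiff G ≤ diffd G X) : IsCritical G X :=
  le_antisymm (diffd_le_critDiff G X) h

/-- The difference `d` is supermodular. -/
theorem diffd_add_diffd_le (X Y : Set V) :
    diffd G X + diffd G Y ≤ diffd G (X ∪ Y) + diffd G (X ∩ Y) := by
  have h₁ := Set.ncard_union_add_ncard_inter X Y
  have h₂ := Set.ncard_union_add_ncard_inter (nbhd G X) (nbhd G Y)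
  have h₃ : nbhd G (X ∪ Y) = nbhd G X ∪ nbhd G Y := by
    ext v; simp only [nbhd, Set.mem_union, Set.mem_ofPred_eq]; grind
  have h₄ : (nbhd G (X ∩ Y)).ncard ≤ (nbhd G X ∩ nbhd G Y).ncard :=
    Set.ncard_le_ncard fun v ⟨x, hx, hv⟩ => ⟨⟨x, hx.1, hv⟩, ⟨x, hx.2, hv⟩⟩
  unfold diffd
  rw [h₃]
  omega

theorem IsCritical.union {X Y : Set V} (hX : IsCritical G X) (hY : IsCritical G Y) :
    IsCritical G (X ∪ Y) := by
  apply isCritical_of_critDiff_le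
  have := diffd_add_diffd_le (G := G) X Y
  have := diffd_le_critDiff G (X ∩ Y)
  unfold IsCritical at hX hY
  omega

theorem isCritical_sUnion {Γ : Set (Set V)} (hne : Γ.Nonempty)
    (hΓ : ∀ S ∈ Γ, IsCritical G S) : IsCritical G (⋃₀ Γ) := by
  induction Γ, Γ.toFinite using Set.Finite.induction_on with
  | empty => exact absurd hne Set.not_nonempty_empty
  | @insert S Δ _ _ ih =>
    rw [Set.sUnion_insert]
    rcases Δ.eq_empty_or_nonempty with rfl | hΔ
    · simpa using hΓ S (by simp)
    · exact (hΓ S (by simp)).union (ih hΔ fun T hT => hΓ T (Set.mem_insert_of_mem _ hT))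

theorem diffd_diff_nbhd_ge (S T : Set V) :
    diffd G T + (nbhd G T ∩ S).ncard - (T ∩ nbhd G S).ncard ≤ diffd G (T \ nbhd G S) := by
  have h₁ := Set.ncard_inter_add_ncard_sdiff_eq_ncard T (nbhd G S)
  have h₂ := Set.ncard_inter_add_ncard_sdiff_eq_ncard (nbhd G T) S
  have h₃ : (nbhd G (T \ nbhd G S)).ncard ≤ (nbhd G T \ S).ncard :=
    Set.ncard_le_ncard fun v ⟨x, hx, hv⟩ => ⟨⟨x, hx.1, hv⟩, fun hS => hx.2 ⟨v, hS, hv.symm⟩⟩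
  unfold diffd
  omega

theorem IsCritical.diff_nbhd {S T : Set V} (hS : IsCritical G S) (hT : IsCritical G T) :
    IsCritical G (T \ nbhd G S) := by
  apply isCritical_of_critDiff_le
  have h₁ := diffd_diff_nbhd_ge (G := G) S T
  have h₂ := diffd_diff_nbhd_ge (G := G) T S
  have h₃ := diffd_le_critDiff G (S \ nbhd G T)
  rw [Set.inter_comm] at h₂
  rw [Set.inter_comm S] at h₂
  unfold IsCritical at hS hT
  omega

theorem maxCritIndepFam_nonempty (G : SimpleGraph V) : (maxCritIndepFam G).Nonempty := by
  obtain ⟨X, hX⟩ := exists_isCritical G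
  obtain ⟨S, ⟨hS, hSc⟩, hmax⟩ := Set.exists_max_image
    {S : Set V | IndepSet G S ∧ IsCritical G S} Set.ncard (Set.toFinite _)
    ⟨X \ nbhd G X, fun u hu v hv h => hu.2 ⟨v, hv.1, h⟩, hX.diff_nbhd hX⟩
  exact ⟨S, hS, hSc, fun T hT hTc => hmax T ⟨hT, hTc⟩⟩

theorem subset_closedNbhd_of_mem_maxCritIndepFam {S T : Set V} (hS : S ∈ maxCritIndepFam G)
    (hT : IndepSet G T) (hTc : IsCritical G T) : T ⊆ closedNbhd G S := by
  obtain ⟨hSi, hSc, hmax⟩ := hS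
  have hle := hmax (S ∪ T \ nbhd G S)
    (by
      rintro u (hu | hu) v (hv | hv) h
      · exact hSi hu hv h
      · exact hv.2 ⟨u, hu, h.symm⟩
      · exact hu.2 ⟨v, hv, h⟩
      · exact hT hu.1 hv.1 h)
    (hSc.union (hSc.diff_nbhd hTc))
  have heq := Set.eq_of_subset_of_ncard_le Set.subset_union_left hle
  intro t ht
  by_cases h : t ∈ nbhd G S
  · exact Or.inl h
  · exact Or.inr (heq ▸ Or.inr ⟨ht, h⟩)

/-- Hall's condition for matching `N(S)` into a critical set `S`. -/
theorem IsCritical.ncard_le_ncard_nbhd_inter {S Y : Set V} (hS : IsCritical G S)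
    (hY : Y ⊆ nbhd G S) : Y.ncard ≤ (nbhd G Y ∩ S).ncard := by
  have h₁ := Set.ncard_inter_add_ncard_sdiff_eq_ncard S (nbhd G Y)
  have h₂ := Set.ncard_sdiff_add_ncard_of_subset hY
  have h₃ : (nbhd G (S \ nbhd G Y)).ncard ≤ (nbhd G S \ Y).ncard :=
    Set.ncard_le_ncard fun v ⟨x, hx, hv⟩ => ⟨⟨x, hx.1, hv⟩, fun h => hx.2 ⟨v, h, hv.symm⟩⟩
  have h₄ := diffd_le_critDiff G (S \ nbhd G Y)
  rw [Set.inter_comm] at h₁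
  unfold IsCritical at hS
  unfold diffd at *
  omega

theorem ncard_sInter_add_ncard_sUnion {Γ : Set (Set V)} (hΓ : Γ ⊆ maxCritIndepFam G)
    {S : Set V} (hS : S ∈ Γ) : (⋂₀ Γ).ncard + (⋃₀ Γ).ncard = 2 * S.ncard := by
  obtain ⟨hSi, hSc, -⟩ := hΓ hS
  have hIS : ⋂₀ Γ ⊆ S := Set.sInter_subset_of_mem hS
  have hSU : S ⊆ ⋃₀ Γ := Set.subset_sUnion_of_mem hS
  have h₁ := Set.ncard_sdiff_add_ncard_of_subset hIS
  have h₂ := Set.ncard_sdiff_add_ncard_of_subset hSU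
  apply le_antisymm
  · have hY : ⋃₀ Γ \ S ⊆ nbhd G S := by
      rintro t ⟨⟨T, hT, htT⟩, htS⟩
      exact (subset_closedNbhd_of_mem_maxCritIndepFam (hΓ hS) (hΓ hT).1 (hΓ hT).2.1
        htT).resolve_right htS
    have h₃ := hSc.ncard_le_ncard_nbhd_inter hY
    have h₄ : (nbhd G (⋃₀ Γ \ S) ∩ S).ncard ≤ (S \ ⋂₀ Γ).ncard := by
      refine Set.ncard_le_ncard ?_
      rintro s ⟨⟨t, ⟨⟨T, hT, htT⟩, -⟩, hst⟩, hsS⟩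
      exact ⟨hsS, fun hsI => (hΓ hT).1 (hsI T hT) htT hst⟩
    omega
  · have hU := isCritical_sUnion ⟨S, hS⟩ fun T hT => (hΓ hT).2.1
    have hN : nbhd G S ∪ S \ ⋂₀ Γ ⊆ nbhd G (⋃₀ Γ) := by
      rintro v (⟨s, hs, hv⟩ | ⟨hvS, hvI⟩)
      · exact ⟨s, hSU hs, hv⟩
      · simp only [Set.mem_sInter, not_forall] at hvI
        obtain ⟨T, hT, hvT⟩ := hvI
        obtain ⟨t, ht, hvt⟩ := (subset_closedNbhd_of_mem_maxCritIndepFam (hΓ hT) hSi hSc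
          hvS).resolve_right hvT
        exact ⟨t, ⟨T, hT, ht⟩, hvt⟩
    have hdisj : Disjoint (nbhd G S) (S \ ⋂₀ Γ) :=
      Set.disjoint_left.2 fun v ⟨s, hs, hv⟩ h => hSi h.1 hs hv
    have h₃ := Set.ncard_le_ncard hN
    rw [Set.ncard_union_eq hdisj] at h₃
    unfold IsCritical diffd at hSc hU
    omega

theorem IsMatchingSet.ncard_le_ncard_compl {M : Set (Sym2 V)} (hM : IsMatchingSet G M)
    {S : Set V} (hS : IndepSet G S) : M.ncard ≤ Sᶜ.ncard := by
  obtain ⟨o, hinj, hmaps, -⟩ := hM.exists_injOn_mapsTo_compl hS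
  exact Set.ncard_le_ncard_of_injOn o hmaps hinj

theorem IsMatchingSet.exists_injOn_compl_adj {M : Set (Sym2 V)} (hM : IsMatchingSet G M)
    {S : Set V} (hS : IndepSet G S) (hcard : Sᶜ.ncard ≤ M.ncard) :
    ∃ f : V → V, Set.InjOn f Sᶜ ∧ ∀ v ∉ S, f v ∈ S ∧ G.Adj v (f v) := by
  obtain ⟨o, hinj, hmaps, ho⟩ := hM.exists_injOn_mapsTo_compl hS
  have himg : o '' M = Sᶜ := Set.eq_of_subset_of_ncard_le hmaps.image_subset
    (by rwa [hinj.ncard_image])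
  have hkey : ∀ e ∈ M, ∀ v ∈ e, v ∉ S → o e = v := by
    intro e he v hv hvS
    obtain ⟨e', he', rfl⟩ : v ∈ o '' M := himg ▸ hvS
    rw [hM.eq_of_mem he he' hv (ho e' he')]
  have h : ∀ v, ∃ w, v ∉ S → w ∈ S ∧ s(v, w) ∈ M := by
    intro v
    by_cases hv : v ∈ S
    · exact ⟨v, fun h => absurd hv h⟩
    obtain ⟨e, he, hev⟩ : v ∈ o '' M := himg ▸ hv
    obtain ⟨w, rfl⟩ := hev ▸ ho e he
    refine ⟨w, fun _ => ⟨by_contra fun hw => ?_, he⟩⟩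
    exact (show G.Adj v w from hM.1 he).ne (hev.symm.trans (hkey _ he w (by simp) hw))
  choose f hf using h
  refine ⟨f, fun u hu v hv huv => ?_, fun v hv => ⟨(hf v hv).1, hM.1 (hf v hv).2⟩⟩
  have := hM.eq_of_mem (hf u hu).2 (hf v hv).2 (v := f u) (by simp) (by simp [huv])
  rw [huv] at this
  exact Sym2.congr_left.1 this

theorem isCritical_of_injOn_compl_adj {S : Set V} (hS : IndepSet G S) {f : V → V}
    (hinj : Set.InjOn f Sᶜ) (hf : ∀ v ∉ S, f v ∈ S ∧ G.Adj v (f v)) : IsCritical G S := by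
  obtain ⟨X, hX⟩ := exists_isCritical G
  apply isCritical_of_critDiff_le
  rw [← hX]
  have h₁ : (X \ S).ncard ≤ (nbhd G X ∩ S).ncard :=
    Set.ncard_le_ncard_of_injOn f
      (fun v hv => ⟨⟨v, hv.1, (hf v hv.2).2.symm⟩, (hf v hv.2).1⟩)
      (hinj.mono fun v hv => hv.2)
  have h₂ : (X ∩ S).ncard ≤ (nbhd G X \ S).ncard + (S \ f '' Sᶜ).ncard := by
    have hsub : X ∩ S ⊆ f '' (nbhd G X \ S) ∪ (S \ f '' Sᶜ) := by
      rintro x ⟨hxX, hxS⟩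
      by_cases hx : x ∈ f '' Sᶜ
      · obtain ⟨v, hv, rfl⟩ := hx
        exact Or.inl ⟨v, ⟨⟨f v, hxX, (hf v hv).2⟩, hv⟩, rfl⟩
      · exact Or.inr ⟨hxS, hx⟩
    have := Set.ncard_le_ncard hsub
    have := Set.ncard_union_le (f '' (nbhd G X \ S)) (S \ f '' Sᶜ)
    have := Set.ncard_image_le (f := f) (nbhd G X \ S).toFinite
    omega
  have h₃ : (S \ f '' Sᶜ).ncard + Sᶜ.ncard = S.ncard := by
    rw [← hinj.ncard_image]
    exact Set.ncard_sdiff_add_ncard_of_subset (by rintro _ ⟨v, hv, rfl⟩; exact (hf v hv).1)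
  have h₄ := Set.ncard_inter_add_ncard_sdiff_eq_ncard X S
  have h₅ := Set.ncard_inter_add_ncard_sdiff_eq_ncard (nbhd G X) S
  have h₆ : (nbhd G S).ncard ≤ Sᶜ.ncard :=
    Set.ncard_le_ncard fun v ⟨s, hs, hv⟩ hvS => hS hvS hs hv
  unfold diffd
  omega

/-- A König-Egerváry graph has a critical maximum independent set. -/
theorem IsKonigEgervary.exists_isCritical (hG : IsKonigEgervary G) :
    ∃ S : Set V, IndepSet G S ∧ IsCritical G S ∧ S.ncard = indNum G := by
  obtain ⟨S, hS, hcard⟩ := exists_indepSet_ncard_eq_indNum G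
  obtain ⟨M, hM, hMcard⟩ := exists_isMatchingSet_ncard_eq_matchNum G
  have := Set.ncard_add_ncard_compl S
  unfold IsKonigEgervary at hG
  obtain ⟨f, hinj, hf⟩ := hM.exists_injOn_compl_adj hS (by omega)
  exact ⟨S, hS, isCritical_of_injOn_compl_adj hS hinj hf, hcard⟩

theorem IsCritical.exists_isMatchingSet {S : Set V} (hS : IndepSet G S) (hSc : IsCritical G S) :
    ∃ M : Set (Sym2 V), IsMatchingSet G M ∧ M.ncard = (nbhd G S).ncard := by
  classical
  have := Fintype.ofFinite V
  obtain ⟨f, hinj, hf⟩ := (Finset.all_card_le_biUnion_card_iff_exists_injective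
    fun v : nbhd G S => {w : V | w ∈ S ∧ G.Adj v w}.toFinset).1 (by
      intro Y
      have h := hSc.ncard_le_ncard_nbhd_inter (Y := Subtype.val '' (Y : Set (nbhd G S)))
        (by rintro _ ⟨v, -, rfl⟩; exact v.2)
      rw [Set.ncard_image_of_injective _ Subtype.val_injective, Set.ncard_coe_finset] at h
      refine h.trans ?_
      rw [← Set.ncard_coe_finset]
      refine Set.ncard_le_ncard ?_
      rintro w ⟨⟨_, ⟨v, hv, rfl⟩, hwv⟩, hw⟩
      simp only [Finset.coe_biUnion, Set.mem_iUnion, Set.coe_toFinset]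
      exact ⟨v, hv, hw, hwv.symm⟩)
  simp only [Set.mem_toFinset, Set.mem_ofPred_eq] at hf
  have hnot : ∀ v : nbhd G S, (v : V) ∉ S := fun ⟨v, s, hs, hv⟩ hvS => hS hvS hs hv
  have hmeet : ∀ u v : nbhd G S, ∀ x, x ∈ s((u : V), f u) → x ∈ s((v : V), f v) → u = v := by
    intro u v x hxu hxv
    rw [Sym2.mem_iff] at hxu hxv
    rcases hxu with rfl | rfl <;> rcases hxv with h | h
    · exact Subtype.ext h
    · exact absurd (h ▸ (hf v).1) (hnot u)
    · exact absurd (h ▸ (hf u).1) (hnot v)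
    · exact hinj h
  refine ⟨Set.range fun v : nbhd G S => s((v : V), f v), ⟨?_, ?_⟩, ?_⟩
  · rintro _ ⟨v, rfl⟩
    exact (hf v).2
  · rintro _ ⟨u, rfl⟩ _ ⟨v, rfl⟩ hne x hxu hxv
    exact hne (by rw [hmeet u v x hxu hxv])
  · rw [← Set.image_univ, Set.ncard_image_of_injective, Set.ncard_univ, Nat.card_coe_set_eq]
    intro u v huv
    dsimp only at huv
    exact hmeet u v u (by simp) (huv ▸ by simp)

theorem isKonigEgervary_of_isCritical {S : Set V} (hS : IndepSet G S) (hSc : IsCritical G S)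
    (hcard : S.ncard = indNum G) : IsKonigEgervary G := by
  have hN : nbhd G S = Sᶜ := by
    refine Set.Subset.antisymm (fun v ⟨s, hs, hv⟩ hvS => hS hvS hs hv) fun v hv => ?_
    by_contra hvN
    have hins : IndepSet G (insert v S) := by
      rintro a (rfl | ha) b (rfl | hb) h
      · exact h.ne rfl
      · exact hvN ⟨b, hb, h⟩
      · exact hvN ⟨a, ha, h.symm⟩
      · exact hS ha hb h
    have := hins.ncard_le_indNum
    rw [Set.ncard_insert_of_notMem hv] at this
    omega
  obtain ⟨M, hM, hMcard⟩ := hSc.exists_isMatchingSet hS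
  obtain ⟨M', hM', hMcard'⟩ := exists_isMatchingSet_ncard_eq_matchNum G
  have h₁ := hM.ncard_le_matchNum
  have h₂ := hM'.ncard_le_ncard_compl hS
  have h₃ := Set.ncard_add_ncard_compl S
  rw [hN] at hMcard
  unfold IsKonigEgervary
  omega

theorem IsKonigEgervary.isKECollection (hG : IsKonigEgervary G) {Γ : Set (Set V)}
    (hne : Γ.Nonempty) (hΓ : Γ ⊆ maxCritIndepFam G) : IsKECollection G Γ := by
  obtain ⟨S, hS⟩ := hne
  obtain ⟨T, hT, hTc, hTcard⟩ := hG.exists_isCritical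
  have h₁ := (hΓ hS).2.2 T hT hTc
  have h₂ := (hΓ hS).1.ncard_le_indNum
  exact ⟨fun R hR => (hΓ hR).1, by rw [ncard_sInter_add_ncard_sUnion hΓ hS]; omega⟩

theorem IsKECollection.isKonigEgervary {Γ : Set (Set V)} (hK : IsKECollection G Γ)
    (hne : Γ.Nonempty) (hΓ : Γ ⊆ maxCritIndepFam G) : IsKonigEgervary G := by
  obtain ⟨S, hS⟩ := hne
  have h := hK.2
  rw [ncard_sInter_add_ncard_sUnion hΓ hS] at h
  exact isKonigEgervary_of_isCritical (hΓ hS).1 (hΓ hS).2.1 (by omega)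

end Criticality

/-- The following are equivalent: (i) `G` is a König-Egerváry graph;
(ii) every nonempty family of maximum critical independent sets of `G` is a
König-Egerváry collection; (iii) there exists a nonempty family of maximum critical
independent sets of `G` that is a König-Egerváry collection. -/
theorem stmt5 {V : Type*} [Fintype V] (G : SimpleGraph V) :
    (IsKonigEgervary G ↔
      ∀ Γ : Set (Set V), Γ.Nonempty → Γ ⊆ maxCritIndepFam G → IsKECollection G Γ) ∧
    (IsKonigEgervary G ↔
      ∃ Γ : Set (Set V), Γ.Nonempty ∧ Γ ⊆ maxCritIndepFam G ∧ IsKECollection G Γ) := by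
  exact ⟨⟨fun hG Γ hne hΓ => hG.isKECollection hne hΓ, fun h =>
      (h _ (maxCritIndepFam_nonempty G) subset_rfl).isKonigEgervary
        (maxCritIndepFam_nonempty G) subset_rfl⟩,
    fun hG => ⟨_, maxCritIndepFam_nonempty G, subset_rfl,
      hG.isKECollection (maxCritIndepFam_nonempty G) subset_rfl⟩,
    fun ⟨_, hne, hΓ, hK⟩ => hK.isKonigEgervary hne hΓ⟩
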